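/- Let ř, p, N be positive integers. Let Ǎ ∈ ℝ^{ř×ř} have all eigenvalues in the closed unit disc, B̌ ∈ ℝ^{ř×p}, Č ∈ ℝ^{p×ř}, let K ∈ ℝ^{p×ř} be such that Ǎ − B̌K is Schur stable and H ∈ ℝ^{ř×p} be such that Ǎ − HČ is Schur stable. For each i = 1,…,N let A_{i,s} ∈ ℝ^{s_i×s_i} be Schur stable and C_{i,s} ∈ ℝ^{p×s_i}. Let D̄ = (d̄_{ij}) ∈ ℝ^{N×N} be lower triangular with nonnegative entries and diagonal entries d̄_{ii} < 1. Let κ_{1r}, …, κ_{Nr} ∈ ℕ satisfy κ_{ir} ≥ κ_{jr} whenever j < i and d̄_{ij} > 0; set κ_{ij} := κ_{ir} − κ_{jr} (and κ_{ij} := 0 when d̄_{ij} = 0), and let κ̂_{ij} ∈ ℕ be arbitrary with κ̂_{ii} = 0. Suppose x̌_r : ℤ → ℝ^{ř} satisfies x̌_r(k+1) = Ǎ x̌_r(k) for all k ∈ ℤ with y_r(k) = Č x̌_r(k), and for i = 1,…,N the sequences x^h_i, x̂_i, χ_i : ℤ → ℝ^{ř} and ω_i : ℤ → ℝ^{s_i}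 satisfy, for all k ≥ 0: x^h_i(k+1) = Ǎ x^h_i(k) + B̌( −K χ_i(k) + C_{i,s} ω_i(k) ), ω_i(k+1) = A_{i,s} ω_i(k), x̂_i(k+1) = Ǎ x̂_i(k) − B̌ K ζ̂_i(k) + H( ζ̄_i(k) − Č x̂_i(k) ), and χ_i(k+1) = Ǎ χ_i(k) − B̌ K χ_i(k) + Ǎ x̂_i(k) − Ǎ ζ̂_i(k), where y_i(k) = Č x^h_i(k), ζ̄_i(k) = y_i(k) − y_r(k − κ_{ir}) − Σ_{j=1}^{N} d̄_{ij} ( y_j(k − κ_{ij}) − y_r(k − κ_{ir}) ) and ζ̂_i(k) = χ_i(k) − Σ_{j=1}^{N} d̄_{ij} χ_j(k − κ̂_{ij}). Then for every i ∈ {1,…,N}, y_i(k) − y_r(k − κ_{ir}) → 0 as k → ∞, i.e., delayed regulated output synchronization is achieved. -/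

import Mathlib

open Matrix Filter Finset

/-- Complexification of a real matrix (entrywise). -/
noncomputable def toC {ι κ : Type*} (M : Matrix ι κ ℝ) : Matrix ι κ ℂ :=
  M.map Complex.ofReal

/-- A square complex matrix is Schur stable if all its eigenvalues lie in the
open unit disc. -/
def SchurStable {ι : Type*} [Fintype ι] [DecidableEq ι] (M : Matrix ι ι ℂ) : Prop :=
  ∀ z ∈ spectrum ℂ M, ‖z‖ < 1

theorem tendsto_mulVec_zero {α ι κ : Type*} [Fintype κ] (M : Matrix ι κ ℝ) {l : Filter α}
    {u : α → κ → ℝ} (hu : Tendsto u l (nhds 0)) :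
    Tendsto (fun k => M *ᵥ u k) l (nhds 0) := by
  have hc : Continuous fun v : κ → ℝ => M *ᵥ v := continuous_const.matrix_mulVec continuous_id
  simpa [Function.comp_def] using (hc.tendsto 0).comp hu

section LinearRecursion

open scoped Matrix.Norms.Operator

theorem norm_toC {ι κ : Type*} [Fintype ι] [Fintype κ] (M : Matrix ι κ ℝ) : ‖toC M‖ = ‖M‖ := by
  simp [toC, Matrix.linfty_opNorm_def]

theorem toC_pow {ι : Type*} [Fintype ι] [DecidableEq ι] (M : Matrix ι ι ℝ) (n : ℕ) :
    toC (M ^ n) = toC M ^ n :=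
  Matrix.map_pow M Complex.ofRealHom n

/-- The powers of an element of a complex Banach algebra with spectrum in the open unit disc are
absolutely summable. -/
theorem summable_norm_pow_of_spectrum_lt_one {A : Type*} [NormedRing A] [NormedAlgebra ℂ A]
    [CompleteSpace A] (a : A) (ha : ∀ z ∈ spectrum ℂ a, ‖z‖ < 1) :
    Summable fun n : ℕ => ‖a ^ n‖ := by
  rcases subsingleton_or_nontrivial A with hA | hA
  · simp [norm_of_subsingleton]
  have hρ : spectralRadius ℂ a < 1 :=
    mod_cast spectrum.spectralRadius_lt_of_forall_lt a (r := 1) fun z hz => ha z hz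
  obtain ⟨r, hρr, hr⟩ := ENNReal.lt_iff_exists_nnreal_btwn.1 hρ
  have hr' : r < 1 := mod_cast hr
  have hev : ∀ᶠ n : ℕ in atTop, ‖a ^ n‖ ≤ (r : ℝ) ^ n := by
    filter_upwards [(spectrum.pow_nnnorm_pow_one_div_tendsto_nhds_spectralRadius a).eventually
      (gt_mem_nhds hρr), eventually_gt_atTop 0] with n hn hn0
    have hn0' : (0 : ℝ) < n := mod_cast hn0
    rw [one_div] at hn
    have h := (ENNReal.rpow_inv_le_iff hn0').1 hn.le
    rw [ENNReal.rpow_natCast] at h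
    exact mod_cast h
  exact .of_norm_bounded_eventually_nat
    (summable_geometric_of_lt_one r.coe_nonneg (mod_cast hr')) (by simpa using hev)

theorem SchurStable.summable_norm_pow {ι : Type*} [Fintype ι] [DecidableEq ι] {M : Matrix ι ι ℝ}
    (hM : SchurStable (toC M)) : Summable fun n : ℕ => ‖M ^ n‖ := by
  simpa only [← toC_pow, norm_toC] using summable_norm_pow_of_spectrum_lt_one (toC M) hM

theorem linear_recursion_eq_sum {ι : Type*} [Fintype ι] [DecidableEq ι] {M : Matrix ι ι ℝ}
    {x w : ℕ → ι → ℝ} (h0 : x 0 = w 0) (h : ∀ k, x (k + 1) = M *ᵥ x k + w (k + 1)) (k : ℕ) :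
    x k = ∑ j ∈ range (k + 1), (M ^ j) *ᵥ w (k - j) := by
  induction k with
  | zero => simp [h0]
  | succ k ih =>
    rw [h, sum_range_succ', ih, Matrix.mulVec_sum]
    simp [pow_succ']

/-- A Schur stable linear recursion driven by a vanishing input converges to zero. -/
theorem SchurStable.tendsto_zero_nat {ι : Type*} [Fintype ι] [DecidableEq ι] {M : Matrix ι ι ℝ}
    (hM : SchurStable (toC M)) {x w : ℕ → ι → ℝ} (h : ∀ k, x (k + 1) = M *ᵥ x k + w k)
    (hw : Tendsto w atTop (nhds 0)) : Tendsto x atTop (nhds 0) := by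
  let v : ℕ → ι → ℝ := fun k => Nat.casesOn k (x 0) w
  have hv : Tendsto v atTop (nhds 0) := (tendsto_add_atTop_iff_nat 1).1 hw
  obtain ⟨B, hB⟩ := hv.norm.bddAbove_range
  have hvB : ∀ k, ‖v k‖ ≤ B := fun k => hB ⟨k, rfl⟩
  let f : ℕ → ℕ → ι → ℝ := fun k j => if j ≤ k then (M ^ j) *ᵥ v (k - j) else 0
  have hx : x = fun k => ∑' j, f k j := by
    funext k
    rw [linear_recursion_eq_sum (x := x) (w := v) rfl h k, tsum_eq_sum (s := range (k + 1))]
    · refine sum_congr rfl fun j hj => ?_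
      rw [Finset.mem_range, Nat.lt_succ_iff] at hj
      simp [f, hj]
    · intro j hj
      rw [Finset.mem_range, Nat.lt_succ_iff] at hj
      simp [f, hj]
  rw [hx, ← tsum_zero (β := ℕ)]
  refine tendsto_tsum_of_dominated_convergence (hM.summable_norm_pow.mul_right B)
    (fun j => ?_) (Eventually.of_forall fun k j => ?_)
  · have h1 := tendsto_mulVec_zero (M ^ j) (hv.comp (tendsto_sub_atTop_nat j))
    refine h1.congr' ?_
    filter_upwards [eventually_ge_atTop j] with k hk
    simp [f, hk]
  · by_cases hj : j ≤ k
    · simp only [f, hj, if_true]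
      exact (Matrix.linfty_opNorm_mulVec _ _).trans
        (mul_le_mul_of_nonneg_left (hvB _) (norm_nonneg _))
    · simp only [f, hj, if_false, norm_zero]
      exact mul_nonneg (norm_nonneg _) ((norm_nonneg _).trans (hvB 0))

end LinearRecursion

theorem SchurStable.tendsto_zero {ι : Type*} [Fintype ι] [DecidableEq ι] {M : Matrix ι ι ℝ}
    (hM : SchurStable (toC M)) {x w : ℤ → ι → ℝ}
    (h : ∀ k : ℤ, 0 ≤ k → x (k + 1) = M *ᵥ x k + w k)
    (hw : Tendsto w atTop (nhds 0)) : Tendsto x atTop (nhds 0) := by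
  rw [← Nat.map_cast_int_atTop, tendsto_map'_iff] at hw ⊢
  exact hM.tendsto_zero_nat (fun k => mod_cast h k k.cast_nonneg) hw

/-- Scaling by a factor in `[0, 1)` makes a matrix with spectrum in the closed unit disc
Schur stable. -/
theorem schurStable_smul {ι : Type*} [Fintype ι] [DecidableEq ι] {M : Matrix ι ι ℝ}
    (hM : ∀ z ∈ spectrum ℂ (toC M), ‖z‖ ≤ 1) {d : ℝ} (hd0 : 0 ≤ d) (hd1 : d < 1) :
    SchurStable (toC (d • M)) := by
  intro z hz
  rcases isEmpty_or_nonempty ι with hι | hι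
  · simp [spectrum.of_subsingleton] at hz
  have hsmul : toC (d • M) = (d : ℂ) • toC M := by
    ext i j
    simp [toC]
  rw [hsmul, spectrum.smul_eq_smul _ _
    (spectrum.nonempty_of_isAlgClosed_of_finiteDimensional ℂ _)] at hz
  obtain ⟨u, hu, rfl⟩ := hz
  have := hM u hu
  simp only [norm_smul, Complex.norm_real, Real.norm_eq_abs, abs_of_nonneg hd0]
  nlinarith [norm_nonneg u]

/-- Convergence of one agent whose exchanged signals are, up to vanishing terms, the multiple
`1 - d` of its own ones. -/
theorem tendsto_zero_of_agent {ι κ : Type*} [Fintype ι] [DecidableEq ι] [Fintype κ]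
    {A : Matrix ι ι ℝ} {B : Matrix ι κ ℝ} {C : Matrix κ ι ℝ} {K : Matrix κ ι ℝ} {H : Matrix ι κ ℝ}
    (hA : ∀ z ∈ spectrum ℂ (toC A), ‖z‖ ≤ 1) (hABK : SchurStable (toC (A - B * K)))
    (hAHC : SchurStable (toC (A - H * C))) {d : ℝ} (hd0 : 0 ≤ d) (hd1 : d < 1)
    {x xhat χ v : ℤ → ι → ℝ} {ρ u : ℤ → κ → ℝ}
    (hρ : Tendsto ρ atTop (nhds 0)) (hu : Tendsto u atTop (nhds 0))
    (hv : Tendsto v atTop (nhds 0))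
    (hx : ∀ k : ℤ, 0 ≤ k → x (k + 1) = A *ᵥ x k + B *ᵥ (-(K *ᵥ χ k) + ρ k))
    (hxhat : ∀ k : ℤ, 0 ≤ k → xhat (k + 1) = A *ᵥ xhat k - (B * K) *ᵥ ((1 - d) • χ k - v k)
      + H *ᵥ ((1 - d) • C *ᵥ x k - u k - C *ᵥ xhat k))
    (hχ : ∀ k : ℤ, 0 ≤ k → χ (k + 1) = A *ᵥ χ k - (B * K) *ᵥ χ k + A *ᵥ xhat k
      - A *ᵥ ((1 - d) • χ k - v k)) :
    Tendsto x atTop (nhds 0) ∧ Tendsto χ atTop (nhds 0) := by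
  have hBρ := tendsto_mulVec_zero B hρ
  have he : Tendsto (fun k => (1 - d) • x k - xhat k) atTop (nhds 0) := by
    refine hAHC.tendsto_zero
      (w := fun k => (1 - d) • B *ᵥ ρ k - (B * K) *ᵥ v k + H *ᵥ u k) (fun k hk => ?_) ?_
    · simp only [hx k hk, hxhat k hk, Matrix.mulVec_add, Matrix.mulVec_sub, Matrix.mulVec_neg,
        Matrix.mulVec_smul, Matrix.sub_mulVec, ← Matrix.mulVec_mulVec]
      module
    · simpa using ((hBρ.const_smul (1 - d)).sub (tendsto_mulVec_zero (B * K) hv)).add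
        (tendsto_mulVec_zero H hu)
  have hδ : Tendsto (fun k => x k - χ k) atTop (nhds 0) := by
    refine (schurStable_smul hA hd0 hd1).tendsto_zero
      (w := fun k => B *ᵥ ρ k + A *ᵥ ((1 - d) • x k - xhat k) - A *ᵥ v k) (fun k hk => ?_) ?_
    · simp only [hx k hk, hχ k hk, Matrix.mulVec_add, Matrix.mulVec_sub, Matrix.mulVec_neg,
        Matrix.mulVec_smul, Matrix.smul_mulVec, ← Matrix.mulVec_mulVec]
      module
    · simpa using (hBρ.add (tendsto_mulVec_zero A he)).sub (tendsto_mulVec_zero A hv)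
  have hx0 : Tendsto x atTop (nhds 0) := by
    refine hABK.tendsto_zero (w := fun k => (B * K) *ᵥ (x k - χ k) + B *ᵥ ρ k) (fun k hk => ?_) ?_
    · simp only [hx k hk, Matrix.mulVec_add, Matrix.mulVec_sub, Matrix.mulVec_neg,
        Matrix.sub_mulVec, ← Matrix.mulVec_mulVec]
      module
    · simpa using (tendsto_mulVec_zero (B * K) hδ).add hBρ
  exact ⟨hx0, by simpa using hx0.sub hδ⟩

theorem tendsto_sum_erase_zero {ι E : Type*} [LinearOrder ι] [Fintype ι]
    [NormedAddCommGroup E] [NormedSpace ℝ E] {D : Matrix ι ι ℝ}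
    (hD : ∀ i j, i < j → D i j = 0) (i : ι) {f : ι → ℤ → E}
    (hf : ∀ j < i, Tendsto (f j) atTop (nhds 0)) (τ : ι → ℤ) :
    Tendsto (fun k => ∑ j ∈ univ.erase i, D i j • f j (k - τ j)) atTop (nhds 0) := by
  rw [← sum_const_zero (s := univ.erase i)]
  refine tendsto_finsetSum _ fun j hj => ?_
  rcases lt_or_gt_of_ne (ne_of_mem_erase hj) with hji | hij
  · simpa [Function.comp_def, sub_eq_add_neg] using ((hf j hji).comp
      (tendsto_atTop_add_const_right _ (-τ j) tendsto_id)).const_smul (D i j)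
  · simp [hD i j hij]

/-- Theorem 3 of the paper (core content, Protocol 3 Step 3): scale-free delayed
regulated output synchronization for the homogenized agents of a heterogeneous MAS. -/
theorem stmt2
    (rr p N : ℕ) (hrr : 0 < rr) (hp : 0 < p) (hN : 0 < N)
    (Ah : Matrix (Fin rr) (Fin rr) ℝ) (Bh : Matrix (Fin rr) (Fin p) ℝ)
    (Ch : Matrix (Fin p) (Fin rr) ℝ)
    (K : Matrix (Fin p) (Fin rr) ℝ) (H : Matrix (Fin rr) (Fin p) ℝ)
    -- all eigenvalues of Ah are in the closed unit disc
    (hAh : ∀ z ∈ spectrum ℂ (toC Ah), ‖z‖ ≤ 1)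
    -- Ah - BhK and Ah - HCh are Schur stable
    (hABK : SchurStable (toC (Ah - Bh * K)))
    (hAHC : SchurStable (toC (Ah - H * Ch)))
    -- homogenization-error dynamics: A_{i,s} Schur stable
    (s : Fin N → ℕ)
    (As : ∀ i : Fin N, Matrix (Fin (s i)) (Fin (s i)) ℝ)
    (hAs : ∀ i : Fin N, SchurStable (toC (As i)))
    (Cs : ∀ i : Fin N, Matrix (Fin p) (Fin (s i)) ℝ)
    -- D̄ lower triangular, nonnegative entries, diagonal entries < 1
    (D : Matrix (Fin N) (Fin N) ℝ)
    (hDlt : ∀ i j : Fin N, i < j → D i j = 0)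
    (hDnonneg : ∀ i j : Fin N, 0 ≤ D i j)
    (hDdiag : ∀ i : Fin N, D i i < 1)
    -- delays
    (κ : Fin N → ℕ)
    (hκ : ∀ i j : Fin N, j < i → 0 < D i j → κ j ≤ κ i)
    (κh : Fin N → Fin N → ℕ) (hκh : ∀ i : Fin N, κh i i = 0)
    -- exosystem and its output
    (xrr : ℤ → Fin rr → ℝ)
    (hxrr : ∀ k : ℤ, xrr (k + 1) = Ah.mulVec (xrr k))
    (yr : ℤ → Fin p → ℝ) (hyr : ∀ k : ℤ, yr k = Ch.mulVec (xrr k))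
    -- compensated agents, protocol states, homogenization errors, outputs
    (xh xhat χ : Fin N → ℤ → Fin rr → ℝ)
    (ω : ∀ i : Fin N, ℤ → Fin (s i) → ℝ)
    (y : Fin N → ℤ → Fin p → ℝ)
    (hy : ∀ (i : Fin N) (k : ℤ), y i k = Ch.mulVec (xh i k))
    -- network measurement ζ̄ and localized exchange ζ̂
    (ζbar : Fin N → ℤ → Fin p → ℝ) (ζhat : Fin N → ℤ → Fin rr → ℝ)
    (hζbar : ∀ (i : Fin N) (k : ℤ), ζbar i k =
      y i k - yr (k - (κ i : ℤ)) -
        ∑ j : Fin N, D i j •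
          (y j (k - (if 0 < D i j then (κ i : ℤ) - (κ j : ℤ) else 0)) - yr (k - (κ i : ℤ))))
    (hζhat : ∀ (i : Fin N) (k : ℤ), ζhat i k =
      χ i k - ∑ j : Fin N, D i j • χ j (k - (κh i j : ℤ)))
    -- closed-loop dynamics for k ≥ 0
    (hxh : ∀ (i : Fin N) (k : ℤ), 0 ≤ k →
      xh i (k + 1) = Ah.mulVec (xh i k)
        + Bh.mulVec (-(K.mulVec (χ i k)) + (Cs i).mulVec (ω i k)))
    (hω : ∀ (i : Fin N) (k : ℤ), 0 ≤ k → ω i (k + 1) = (As i).mulVec (ω i k))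
    (hxhat : ∀ (i : Fin N) (k : ℤ), 0 ≤ k →
      xhat i (k + 1) = Ah.mulVec (xhat i k) - (Bh * K).mulVec (ζhat i k)
        + H.mulVec (ζbar i k - Ch.mulVec (xhat i k)))
    (hχ : ∀ (i : Fin N) (k : ℤ), 0 ≤ k →
      χ i (k + 1) = Ah.mulVec (χ i k) - (Bh * K).mulVec (χ i k)
        + Ah.mulVec (xhat i k) - Ah.mulVec (ζhat i k)) :
    -- delayed regulated output synchronization
    ∀ i : Fin N, Tendsto (fun k : ℤ => y i k - yr (k - (κ i : ℤ))) atTop (nhds 0) := by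
  have hshift : ∀ i k, xrr (k + 1 - (κ i : ℤ)) = Ah *ᵥ xrr (k - κ i) := fun i k => by
    rw [← hxrr]
    congr 1
    ring
  have hy' : ∀ i k, y i k - yr (k - κ i) = Ch *ᵥ (xh i k - xrr (k - κ i)) := fun i k => by
    rw [hy, hyr, Matrix.mulVec_sub]
  have hsync : ∀ i : Fin N, Tendsto (fun k => xh i k - xrr (k - κ i)) atTop (nhds 0) ∧
      Tendsto (χ i) atTop (nhds 0) := by
    intro i
    induction i using WellFoundedLT.induction with
    | ind i ih =>
      have hω0 : Tendsto (ω i) atTop (nhds 0) :=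
        (hAs i).tendsto_zero (w := 0) (fun k hk => by simp [hω i k hk]) tendsto_const_nhds
      have hu := tendsto_sum_erase_zero hDlt i
        (f := fun j k => y j k - yr (k - κ j))
        (fun j hj => by simpa only [hy'] using tendsto_mulVec_zero Ch (ih j hj).1)
        (fun j => (κ i : ℤ) - κ j)
      have hv := tendsto_sum_erase_zero hDlt i (fun j hj => (ih j hj).2) (fun j => (κh i j : ℤ))
      have hbar : ∀ k, ζbar i k = (1 - D i i) • Ch *ᵥ (xh i k - xrr (k - κ i)) -
          ∑ j ∈ univ.erase i, D i j • (y j (k - ((κ i : ℤ) - κ j)) -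
            yr (k - ((κ i : ℤ) - κ j) - κ j)) := fun k => by
        have hsum : ∀ j, D i j • (y j (k - (if 0 < D i j then (κ i : ℤ) - (κ j : ℤ) else 0)) -
            yr (k - (κ i : ℤ))) = D i j • (y j (k - ((κ i : ℤ) - κ j)) -
            yr (k - ((κ i : ℤ) - κ j) - κ j)) := fun j => by
          rcases (hDnonneg i j).eq_or_lt with h0 | h0
          · simp [← h0]
          · rw [if_pos h0, show k - ((κ i : ℤ) - κ j) - κ j = k - κ i by ring]
        rw [hζbar, sum_congr rfl fun j _ => hsum j, ← add_sum_erase _ _ (mem_univ i), ← hy']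
        simp only [sub_self, sub_zero]
        module
      have hhat : ∀ k, ζhat i k = (1 - D i i) • χ i k -
          ∑ j ∈ univ.erase i, D i j • χ j (k - κh i j) := fun k => by
        rw [hζhat, ← add_sum_erase _ _ (mem_univ i), hκh]
        simp only [Nat.cast_zero, sub_zero]
        module
      refine tendsto_zero_of_agent hAh hABK hAHC (hDnonneg i i) (hDdiag i)
        (tendsto_mulVec_zero (Cs i) hω0) hu hv (fun k hk => ?_) (xhat := xhat i) (fun k hk => ?_)
        (fun k hk => ?_)
      · rw [hxh i k hk, hshift, Matrix.mulVec_sub]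
        abel
      · rw [hxhat i k hk, hhat, hbar]
      · rw [hχ i k hk, hhat]
  intro i
  simpa only [hy'] using tendsto_mulVec_zero Ch (hsync i).1
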